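/- arXiv:1012.0230 — 2 statements merged into one kernel-verified Lean document; each statement's English description precedes it below -/
import Mathlib

section
/- Let x, y, z ∈ ℝ² be affinely independent, let u be a point in the open triangle △xyz, and let S be a finite set of points contained in the open triangle △xyz with u ∈ S, such that no point of S \ {u} lies on any of the closed segments [x,u], [y,u], [z,u]. Then N_S(△xuy) + N_S(△yuz) + N_S(△zux) = |S| − 1. -/
open scoped Classical

/-- Number of points of `S` strictly inside the triangle with vertices `a`, `b`, `c`
(the interior of the convex hull of `{a, b, c}`). -/
noncomputable def NTri (S : Finset (ℝ × ℝ)) (a b c : ℝ × ℝ) : ℕ :=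
  (S.filter (fun p => p ∈ interior (convexHull ℝ ({a, b, c} : Set (ℝ × ℝ))))).card

/-- A set of points in the plane is in general position if no three distinct
points of it are collinear. -/
def GenPos (P : Set (ℝ × ℝ)) : Prop :=
  ∀ p ∈ P, ∀ q ∈ P, ∀ r ∈ P,
    p ≠ q → p ≠ r → q ≠ r → ¬ Collinear ℝ ({p, q, r} : Set (ℝ × ℝ))

/-- Twice the signed area of the triangle with vertices `a`, `b`, `c`. -/
def signedArea (a b c : ℝ × ℝ) : ℝ :=
  (b.1 - a.1) * (c.2 - a.2) - (b.2 - a.2) * (c.1 - a.1)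

lemma affineIndependent_iff_signedArea_ne_zero (a b c : ℝ × ℝ) :
    AffineIndependent ℝ ![a, b, c] ↔ signedArea a b c ≠ 0 := by
  have key : AffineIndependent ℝ ![a, b, c] ↔ LinearIndependent ℝ ![b - a, c - a] := by
    rw [affineIndependent_iff_linearIndependent_vsub ℝ _ (0 : Fin 3),
      ← linearIndependent_equiv (finSuccAboveEquiv (0 : Fin 3))]
    apply iff_of_eq
    congr 1
    ext i <;> fin_cases i <;> simp [finSuccAboveEquiv]
  rw [key, LinearIndependent.pair_iff]
  simp only [Prod.ext_iff, Prod.fst_add, Prod.snd_add, Prod.smul_fst, Prod.smul_snd,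
    Prod.fst_sub, Prod.snd_sub, smul_eq_mul, Prod.fst_zero, Prod.snd_zero, signedArea]
  constructor
  · intro h h0
    obtain ⟨h1, h2⟩ := h (c.1 - a.1) (-(b.1 - a.1)) ⟨by ring, by linear_combination -h0⟩
    obtain ⟨h3, h4⟩ := h (c.2 - a.2) (-(b.2 - a.2)) ⟨by linear_combination h0, by ring⟩
    obtain ⟨h5, -⟩ := h 1 0 ⟨by linear_combination -h2, by linear_combination -h4⟩
    exact one_ne_zero h5
  · rintro h s t ⟨h1, h2⟩
    constructor
    · refine (mul_eq_zero.1 ?_).resolve_right h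
      linear_combination (c.2 - a.2) * h1 - (c.1 - a.1) * h2
    · refine (mul_eq_zero.1 ?_).resolve_right h
      linear_combination (b.1 - a.1) * h2 - (b.2 - a.2) * h1

lemma mem_interior_triangle_iff {a b c : ℝ × ℝ} (h : signedArea a b c ≠ 0) (p : ℝ × ℝ) :
    p ∈ interior (convexHull ℝ ({a, b, c} : Set (ℝ × ℝ))) ↔
      0 < signedArea p b c / signedArea a b c ∧ 0 < signedArea a p c / signedArea a b c ∧
        0 < signedArea a b p / signedArea a b c := by
  have hind := (affineIndependent_iff_signedArea_ne_zero a b c).2 h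
  have htop : affineSpan ℝ (Set.range ![a, b, c]) = ⊤ :=
    hind.affineSpan_eq_top_iff_card_eq_finrank_add_one.2 (by simp)
  let B : AffineBasis (Fin 3) ℝ (ℝ × ℝ) := ⟨![a, b, c], hind, htop⟩
  have hB : (B : Fin 3 → ℝ × ℝ) = ![a, b, c] := rfl
  have hrange : Set.range B = {a, b, c} := by
    rw [hB, Matrix.range_cons, Matrix.range_cons_cons_empty]; rfl
  have hsum := B.sum_coord_apply_eq_one p
  have hcomb := B.linear_combination_coord_eq_self p
  rw [Fin.sum_univ_three] at hsum hcomb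
  simp only [hB, Matrix.cons_val, Prod.ext_iff, Prod.fst_add, Prod.snd_add, Prod.smul_fst,
    Prod.smul_snd, smul_eq_mul] at hcomb
  obtain ⟨h1, h2⟩ := hcomb
  have hr : B.coord 0 p = 1 - B.coord 1 p - B.coord 2 p := by linarith
  have e0 : signedArea p b c / signedArea a b c = B.coord 0 p := by
    rw [div_eq_iff h, signedArea, signedArea, ← h1, ← h2, hr]; ring
  have e1 : signedArea a p c / signedArea a b c = B.coord 1 p := by
    rw [div_eq_iff h, signedArea, signedArea, ← h1, ← h2, hr]; ring
  have e2 : signedArea a b p / signedArea a b c = B.coord 2 p := by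
    rw [div_eq_iff h, signedArea, signedArea, ← h1, ← h2, hr]; ring
  rw [← hrange, B.interior_convexHull, e0, e1, e2]
  simp [Fin.forall_fin_succ]

/-- If `u` and `p` are affine combinations of `x`, `y`, `z` with positive weights `a, b, c` and
`α, β, γ`, then `p` is in the open triangle `x u y` iff `γ / c` is the strict minimum of
`α / a`, `β / b`, `γ / c`. -/
lemma mem_interior_subtriangle_iff {x y z u p : ℝ × ℝ} {a b c α β γ : ℝ}
    (h : signedArea x y z ≠ 0) (hc : 0 < c) (hγ : 0 < γ)
    (habc : a + b + c = 1) (hu : u = a • x + b • y + c • z)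
    (hαβγ : α + β + γ = 1) (hp : p = α • x + β • y + γ • z) :
    p ∈ interior (convexHull ℝ ({x, u, y} : Set (ℝ × ℝ))) ↔ γ * a < α * c ∧ γ * b < β * c := by
  obtain rfl : a = 1 - b - c := by linarith
  obtain rfl : α = 1 - β - γ := by linarith
  have hd : signedArea x u y = -c * signedArea x y z := by
    subst hu; simp [signedArea]; ring
  have hd0 : signedArea x u y ≠ 0 := by rw [hd]; exact mul_ne_zero (by linarith) h
  rw [mem_interior_triangle_iff hd0]
  have e0 : signedArea p u y / signedArea x u y = ((1 - β - γ) * c - γ * (1 - b - c)) / c := by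
    rw [div_eq_div_iff hd0 hc.ne', hd]; subst hu hp; simp [signedArea]; ring
  have e1 : signedArea x p y / signedArea x u y = γ / c := by
    rw [div_eq_div_iff hd0 hc.ne', hd]; subst hp; simp [signedArea]; ring
  have e2 : signedArea x u p / signedArea x u y = (β * c - γ * b) / c := by
    rw [div_eq_div_iff hd0 hc.ne', hd]; subst hu hp; simp [signedArea]; ring
  rw [e0, e1, e2, div_pos_iff_of_pos_right hc, div_pos_iff_of_pos_right hc,
    div_pos_iff_of_pos_right hc, sub_pos, sub_pos]
  tauto

/-- With weights as in `mem_interior_subtriangle_iff`, if `α / a = β / b ≤ γ / c` then `p` lies on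
the segment from `z` to `u`. -/
lemma mem_segment_of_weights {x y z u p : ℝ × ℝ} {a b c α β γ : ℝ}
    (ha : 0 < a) (hα : 0 < α)
    (habc : a + b + c = 1) (hu : u = a • x + b • y + c • z)
    (hαβγ : α + β + γ = 1) (hp : p = α • x + β • y + γ • z)
    (hab : α * b = β * a) (hac : α * c ≤ γ * a) : p ∈ segment ℝ z u := by
  obtain ⟨t, rfl⟩ : ∃ t, α = t * a := ⟨α / a, by field_simp⟩
  have ht : 0 < t := pos_of_mul_pos_left hα ha.le
  have hb : β = t * b := mul_right_cancel₀ ha.ne' (by linarith)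
  have hle : t * c ≤ γ := le_of_mul_le_mul_right (by linarith) ha
  refine ⟨γ - t * c, t, by linarith, ht.le, ?_, ?_⟩
  · linear_combination hαβγ - hb - t * habc
  · rw [hp, hu, hb]
    module

lemma exists_weights_of_mem_interior {x y z p : ℝ × ℝ} (h : signedArea x y z ≠ 0)
    (hp : p ∈ interior (convexHull ℝ ({x, y, z} : Set (ℝ × ℝ)))) :
    ∃ α β γ : ℝ, 0 < α ∧ 0 < β ∧ 0 < γ ∧ α + β + γ = 1 ∧ p = α • x + β • y + γ • z := by
  obtain ⟨hα, hβ, hγ⟩ := (mem_interior_triangle_iff h p).1 hp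
  refine ⟨_, _, _, hα, hβ, hγ, ?_, ?_⟩
  · field_simp; simp only [signedArea]; ring
  · ext <;> simp only [Prod.fst_add, Prod.snd_add, Prod.smul_fst, Prod.smul_snd, smul_eq_mul] <;>
      field_simp <;> simp only [signedArea] <;> ring

/-- Counting identity: if `u ∈ S` lies inside `△xyz`, all of `S` lies inside `△xyz`,
and no other point of `S` lies on the closed segments `[x,u]`, `[y,u]`, `[z,u]`,
then the three sub-triangles at `u` contain exactly `|S| - 1` points of `S`. -/
theorem stmt3 (x y z u : ℝ × ℝ) (hxyz : AffineIndependent ℝ ![x, y, z])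
    (hu : u ∈ interior (convexHull ℝ ({x, y, z} : Set (ℝ × ℝ))))
    (S : Finset (ℝ × ℝ))
    (hS : ∀ p ∈ S, p ∈ interior (convexHull ℝ ({x, y, z} : Set (ℝ × ℝ))))
    (huS : u ∈ S)
    (hseg : ∀ p ∈ S, p ≠ u →
      p ∉ segment ℝ x u ∧ p ∉ segment ℝ y u ∧ p ∉ segment ℝ z u) :
    NTri S x u y + NTri S y u z + NTri S z u x = S.card - 1 := by
  have hd := (affineIndependent_iff_signedArea_ne_zero x y z).1 hxyz
  have hd₁ : signedArea y z x ≠ 0 := by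
    convert hd using 1; simp only [signedArea]; ring
  have hd₂ : signedArea z x y ≠ 0 := by
    convert hd using 1; simp only [signedArea]; ring
  obtain ⟨a, b, c, ha, hb, hc, habc, hu'⟩ := exists_weights_of_mem_interior hd hu
  have hu₁ : u = b • y + c • z + a • x := by rw [hu']; abel
  have hu₂ : u = c • z + a • x + b • y := by rw [hu']; abel
  simp only [NTri, Finset.card_filter]
  rw [← Finset.card_erase_of_mem huS, Finset.card_eq_sum_ones, ← Finset.sum_add_distrib,
    ← Finset.sum_add_distrib, ← Finset.add_sum_erase S _ huS]
  rw [mem_interior_subtriangle_iff hd hc hc habc hu' habc hu',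
    mem_interior_subtriangle_iff hd₁ ha ha (by linarith) hu₁ (by linarith) hu₁,
    mem_interior_subtriangle_iff hd₂ hb hb (by linarith) hu₂ (by linarith) hu₂]
  rw [if_neg (by rintro ⟨h, -⟩; linarith), if_neg (by rintro ⟨h, -⟩; linarith),
    if_neg (by rintro ⟨h, -⟩; linarith), add_zero, add_zero, zero_add]
  refine Finset.sum_congr rfl fun p hp => ?_
  obtain ⟨hpu, hpS⟩ := Finset.mem_erase.1 hp
  obtain ⟨hx, hy, hz⟩ := hseg p hpS hpu
  obtain ⟨α, β, γ, hα, hβ, hγ, hαβγ, hp'⟩ := exists_weights_of_mem_interior hd (hS p hpS)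
  have hp₁ : p = β • y + γ • z + α • x := by rw [hp']; abel
  have hp₂ : p = γ • z + α • x + β • y := by rw [hp']; abel
  rw [mem_interior_subtriangle_iff hd hc hγ habc hu' hαβγ hp',
    mem_interior_subtriangle_iff hd₁ ha hα (by linarith) hu₁ (by linarith) hp₁,
    mem_interior_subtriangle_iff hd₂ hb hβ (by linarith) hu₂ (by linarith) hp₂]
  have nz : ¬ (α * b = β * a ∧ α * c ≤ γ * a) := fun h =>
    hz (mem_segment_of_weights ha hα habc hu' hαβγ hp' h.1 h.2)
  have nx : ¬ (β * c = γ * b ∧ β * a ≤ α * b) := fun h =>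
    hx (mem_segment_of_weights hb hβ (by linarith) hu₁ (by linarith) hp₁ h.1 h.2)
  have ny : ¬ (γ * a = α * c ∧ γ * b ≤ β * c) := fun h =>
    hy (mem_segment_of_weights hc hγ (by linarith) hu₂ (by linarith) hp₂ h.1 h.2)
  have cAB : α * b < β * a ↔ α / a < β / b := (div_lt_div_iff₀ ha hb).symm
  have cBA : β * a < α * b ↔ β / b < α / a := (div_lt_div_iff₀ hb ha).symm
  have cAC : α * c < γ * a ↔ α / a < γ / c := (div_lt_div_iff₀ ha hc).symm
  have cCA : γ * a < α * c ↔ γ / c < α / a := (div_lt_div_iff₀ hc ha).symm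
  have cBC : β * c < γ * b ↔ β / b < γ / c := (div_lt_div_iff₀ hb hc).symm
  have cCB : γ * b < β * c ↔ γ / c < β / b := (div_lt_div_iff₀ hc hb).symm
  rw [← div_eq_div_iff ha.ne' hb.ne', ← div_le_div_iff₀ ha hc] at nz
  rw [← div_eq_div_iff hb.ne' hc.ne', ← div_le_div_iff₀ hb ha] at nx
  rw [← div_eq_div_iff hc.ne' ha.ne', ← div_le_div_iff₀ hc hb] at ny
  rw [cCA, cCB, cAB, cAC, cBC, cBA]
  clear cCA cCB cAB cAC cBC cBA
  generalize α / a = A at *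
  generalize β / b = B at *
  generalize γ / c = C at *
  grind
end

section
/- Let x, y, z ∈ ℝ² be affinely independent, and let S be a finite set of points contained in the open triangle △xyz such that S ∪ {x, y, z} is in general position. Let n₁, n₂, n₃ be natural numbers with n₁ + n₂ + n₃ = |S| − 1. Let v₁, v₂ be points of the open segment (y, z) with v₁ on the closed segment [y, v₂], such that no point of S lies on the closed segment [x,v₁] or on the closed segment [x,v₂], and such that N_S(△xv₁y) = n₁ and N_S(△xv₂z) = n₃. If u ∈ S satisfies N_S(△xuy) = n₁, N_S(△yuz) = n₂, and N_S(△zux) = n₃, then u lies in the open triangle △xv₁v₂. -/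
open scoped Classical

theorem det_ne_zero_of_affineIndependent {a b c : ℝ × ℝ} (h : AffineIndependent ℝ ![a, b, c]) :
    (b.1 - a.1) * (c.2 - a.2) - (b.2 - a.2) * (c.1 - a.1) ≠ 0 := by
  intro h0
  have hc : Collinear ℝ ({a, b, c} : Set (ℝ × ℝ)) := by
    by_cases hab : b = a
    · subst hab
      simpa using collinear_pair ℝ b c
    · rw [collinear_iff_of_mem (p₀ := a) (by simp)]
      refine ⟨b - a, ?_⟩
      have hn : (b.1 - a.1) ^ 2 + (b.2 - a.2) ^ 2 ≠ 0 := by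
        intro h1
        apply hab
        ext <;> nlinarith [sq_nonneg (b.1 - a.1), sq_nonneg (b.2 - a.2)]
      intro p hp
      simp only [Set.mem_insert_iff, Set.mem_singleton_iff] at hp
      rcases hp with rfl | rfl | rfl
      · exact ⟨0, by simp⟩
      · exact ⟨1, by simp⟩
      · refine ⟨((b.1 - a.1) * (p.1 - a.1) + (b.2 - a.2) * (p.2 - a.2)) /
          ((b.1 - a.1) ^ 2 + (b.2 - a.2) ^ 2), ?_⟩
        ext
        · simp only [vadd_eq_add, Prod.fst_add, Prod.smul_fst, Prod.fst_sub, smul_eq_mul]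
          field_simp
          linear_combination (-(b.2 - a.2)) * h0
        · simp only [vadd_eq_add, Prod.snd_add, Prod.smul_snd, Prod.snd_sub, smul_eq_mul]
          field_simp
          linear_combination (b.1 - a.1) * h0
  exact (affineIndependent_iff_not_collinear_set.mp h) hc

theorem affineIndependent_of_det_ne_zero {a b c : ℝ × ℝ}
    (h : (b.1 - a.1) * (c.2 - a.2) - (b.2 - a.2) * (c.1 - a.1) ≠ 0) :
    AffineIndependent ℝ ![a, b, c] := by
  rw [affineIndependent_iff_not_collinear_set, collinear_iff_of_mem (p₀ := a) (by simp)]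
  rintro ⟨v, hv⟩
  obtain ⟨r, rfl⟩ := hv b (by simp)
  obtain ⟨s, rfl⟩ := hv c (by simp)
  apply h
  simp
  ring

theorem range_vec_three {α : Type*} (a b c : α) : Set.range ![a, b, c] = {a, b, c} := by
  ext q
  simp [eq_comm]
  tauto

theorem mem_interior_convexHull_triangle_iff {a b c : ℝ × ℝ} (h : AffineIndependent ℝ ![a, b, c])
    (p : ℝ × ℝ) : p ∈ interior (convexHull ℝ ({a, b, c} : Set (ℝ × ℝ))) ↔
      ∃ α β γ : ℝ, 0 < α ∧ 0 < β ∧ 0 < γ ∧ α + β + γ = 1 ∧ p = α • a + β • b + γ • c := by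
  have htop : affineSpan ℝ (Set.range ![a, b, c]) = ⊤ := by
    rw [h.affineSpan_eq_top_iff_card_eq_finrank_add_one]
    simp
  let B : AffineBasis (Fin 3) ℝ (ℝ × ℝ) := ⟨![a, b, c], h, htop⟩
  have hr : Set.range B = ({a, b, c} : Set (ℝ × ℝ)) := range_vec_three a b c
  have e0 : B 0 = a := rfl
  have e1 : B 1 = b := rfl
  have e2 : B 2 = c := rfl
  rw [← hr, B.interior_convexHull]
  constructor
  · intro hp
    refine ⟨B.coord 0 p, B.coord 1 p, B.coord 2 p, hp 0, hp 1, hp 2, ?_, ?_⟩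
    · rw [← Fin.sum_univ_three fun i => B.coord i p, B.sum_coord_apply_eq_one]
    · rw [← e0, ← e1, ← e2, ← Fin.sum_univ_three fun i => B.coord i p • B i,
        B.linear_combination_coord_eq_self]
  · rintro ⟨α, β, γ, hα, hβ, hγ, hs, rfl⟩ i
    have hw : ∑ i, ![α, β, γ] i = 1 := by simpa [Fin.sum_univ_three] using hs
    have := B.coord_apply_combination_of_mem (Finset.mem_univ i) hw
    rw [Finset.affineCombination_eq_linear_combination _ _ _ hw] at this
    simp only [Fin.sum_univ_three, e0, e1, e2] at this
    simp only [Matrix.cons_val_zero, Matrix.cons_val_one, Matrix.cons_val] at this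
    rw [this]
    fin_cases i <;> simpa

theorem affineIndependent_of_mem_interior_convexHull {a b c p : ℝ × ℝ}
    (hp : p ∈ interior (convexHull ℝ ({a, b, c} : Set (ℝ × ℝ)))) :
    AffineIndependent ℝ ![a, b, c] := by
  have htop := interior_convexHull_nonempty_iff_affineSpan_eq_top.mp ⟨p, hp⟩
  rw [affineIndependent_iff_finrank_vectorSpan_eq ℝ _ (n := 2) (by simp), range_vec_three,
    ← direction_affineSpan, htop, AffineSubspace.direction_top, finrank_top]
  simp

theorem vertex_notMem_interior_convexHull (a p b : ℝ × ℝ) :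
    p ∉ interior (convexHull ℝ ({a, p, b} : Set (ℝ × ℝ))) := by
  intro hp
  have hi := affineIndependent_of_mem_interior_convexHull hp
  obtain ⟨α, β, γ, hα, hβ, hγ, hs, he⟩ := (mem_interior_convexHull_triangle_iff hi p).mp hp
  have h1 := congrArg Prod.fst he
  have h2 := congrArg Prod.snd he
  simp at h1 h2
  obtain rfl : α = 1 - β - γ := by linarith
  have hd := det_ne_zero_of_affineIndependent hi
  have : (1 - β) * ((p.1 - a.1) * (b.2 - a.2) - (p.2 - a.2) * (b.1 - a.1)) = 0 := by
    linear_combination (b.2 - a.2) * h1 - (b.1 - a.1) * h2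
  rcases mul_eq_zero.mp this with h | h
  · linarith
  · exact hd h

theorem NTri_lt_of_mem_interior {S : Finset (ℝ × ℝ)} {a v b u : ℝ × ℝ} (hu : u ∈ S)
    (h : u ∈ interior (convexHull ℝ ({a, v, b} : Set (ℝ × ℝ)))) :
    NTri S a u b < NTri S a v b := by
  have hsub : convexHull ℝ ({a, u, b} : Set (ℝ × ℝ)) ⊆ convexHull ℝ {a, v, b} := by
    refine convexHull_min ?_ (convex_convexHull ℝ _)
    rintro q (rfl | rfl | rfl)
    · exact subset_convexHull ℝ _ (by simp)
    · exact interior_subset h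
    · exact subset_convexHull ℝ _ (by simp)
  refine Finset.card_lt_card (Finset.ssubset_iff_of_subset ?_ |>.mpr ⟨u, ?_, ?_⟩)
  · exact Finset.monotone_filter_right S fun q _ hq => interior_mono hsub hq
  · exact Finset.mem_filter.mpr ⟨hu, h⟩
  · exact fun hm => vertex_notMem_interior_convexHull a u b (Finset.mem_filter.mp hm).2

theorem NTri_reverse (S : Finset (ℝ × ℝ)) (a b c : ℝ × ℝ) : NTri S a b c = NTri S c b a := by
  have : ({a, b, c} : Set (ℝ × ℝ)) = {c, b, a} := by
    ext q
    simp only [Set.mem_insert_iff, Set.mem_singleton_iff]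
    tauto
  simp only [NTri, this]

/-- The cevian from `x` through `α • x + β • y + γ • z` meets the line `yz` with parameter
`γ / (β + γ)`; if this lies strictly between `s` and `t`, the point is in the open triangle spanned
by `x` and the points of the line `yz` with parameters `s` and `t`. -/
theorem mem_interior_convexHull_of_lt {x y z : ℝ × ℝ} (h : AffineIndependent ℝ ![x, y, z])
    {s t α β γ : ℝ} (hst : s < t) (hα : 0 < α) (hsum : α + β + γ = 1)
    (hs : s * (β + γ) < γ) (ht : γ < t * (β + γ)) :
    α • x + β • y + γ • z ∈ interior (convexHull ℝ
      ({x, (1 - s) • y + s • z, (1 - t) • y + t • z} : Set (ℝ × ℝ))) := by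
  have hd := det_ne_zero_of_affineIndependent h
  have hts : 0 < t - s := sub_pos.mpr hst
  have hi : AffineIndependent ℝ ![x, (1 - s) • y + s • z, (1 - t) • y + t • z] := by
    apply affineIndependent_of_det_ne_zero
    convert mul_ne_zero hts.ne' hd using 1
    simp
    ring
  rw [mem_interior_convexHull_triangle_iff hi]
  refine ⟨α, (t * (β + γ) - γ) / (t - s), (γ - s * (β + γ)) / (t - s), hα,
    div_pos (by linarith) hts, div_pos (by linarith) hts, ?_, ?_⟩
  · field_simp
    linear_combination (t - s) * hsum
  · ext <;> simp <;> field_simp <;> ring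

/-- Correctness of Step 6: the valid image `u` of the representative vertex, if it
exists, must lie strictly inside the triangle `△xv₁v₂`. -/
theorem stmt9 (x y z : ℝ × ℝ) (hxyz : AffineIndependent ℝ ![x, y, z])
    (S : Finset (ℝ × ℝ))
    (hS : ∀ p ∈ S, p ∈ interior (convexHull ℝ ({x, y, z} : Set (ℝ × ℝ))))
    (hgp : GenPos ((S : Set (ℝ × ℝ)) ∪ {x, y, z}))
    (n₁ n₂ n₃ : ℕ) (hn : n₁ + n₂ + n₃ = S.card - 1)
    (v₁ v₂ : ℝ × ℝ) (hv₁ : v₁ ∈ openSegment ℝ y z) (hv₂ : v₂ ∈ openSegment ℝ y z)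
    (horder : v₁ ∈ segment ℝ y v₂)
    (hseg : ∀ p ∈ S, p ∉ segment ℝ x v₁ ∧ p ∉ segment ℝ x v₂)
    (hc1 : NTri S x v₁ y = n₁) (hc3 : NTri S x v₂ z = n₃)
    (u : ℝ × ℝ) (hu : u ∈ S)
    (h1 : NTri S x u y = n₁) (h2 : NTri S y u z = n₂) (h3 : NTri S z u x = n₃) :
    u ∈ interior (convexHull ℝ ({x, v₁, v₂} : Set (ℝ × ℝ))) := by
  obtain ⟨α, β, γ, hα, hβ, hγ, hsum, rfl⟩ :=
    (mem_interior_convexHull_triangle_iff hxyz u).mp (hS u hu)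
  obtain ⟨s', s, -, hs0, hs1, rfl⟩ := hv₁
  obtain ⟨t', t, ht0', ht0, ht1, rfl⟩ := hv₂
  obtain rfl : s' = 1 - s := by linarith
  obtain rfl : t' = 1 - t := by linarith
  have hd := det_ne_zero_of_affineIndependent hxyz
  have hst : s ≤ t := by
    obtain ⟨k', k, hk', hk, hk1, he⟩ := horder
    obtain rfl : k' = 1 - k := by linarith
    have e1 := congrArg Prod.fst he
    have e2 := congrArg Prod.snd he
    simp at e1 e2
    have h0 : (s - k * t) * ((y.1 - x.1) * (z.2 - x.2) - (y.2 - x.2) * (z.1 - x.1)) = 0 := by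
      linear_combination (y.2 - x.2) * e1 - (y.1 - x.1) * e2
    have h0' := (mul_eq_zero.mp h0).resolve_right hd
    nlinarith
  have hcevian : ∀ r : ℝ, γ = r * (β + γ) →
      α • x + β • y + γ • z ∈ segment ℝ x ((1 - r) • y + r • z) := by
    intro r hr
    refine ⟨α, β + γ, hα.le, by linarith, by linarith, ?_⟩
    ext <;> simp
    · linear_combination (y.1 - z.1) * hr
    · linear_combination (y.2 - z.2) * hr
  have hs : s * (β + γ) < γ := by
    by_contra! hle
    have hlt : γ < s * (β + γ) :=
      lt_of_le_of_ne hle fun h => (hseg _ hu).1 (hcevian s h)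
    have hm := mem_interior_convexHull_of_lt hxyz hs0 hα hsum (by linarith) hlt
    rw [Set.pair_comm] at hm
    simp only [sub_zero, one_smul, zero_smul, add_zero] at hm
    have := NTri_lt_of_mem_interior hu hm
    omega
  have ht : γ < t * (β + γ) := by
    by_contra! hle
    have hlt : t * (β + γ) < γ :=
      lt_of_le_of_ne hle fun h => (hseg _ hu).2 (hcevian t h.symm)
    have hm := mem_interior_convexHull_of_lt hxyz (show t < 1 by linarith) hα hsum hlt
      (by linarith)
    simp only [sub_self, one_smul, zero_smul, zero_add] at hm
    have := NTri_lt_of_mem_interior hu hm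
    rw [NTri_reverse] at h3
    omega
  exact mem_interior_convexHull_of_lt hxyz (by nlinarith) hα hsum hs ht
end
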